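/- Let p be the pattern urruurr (which is depth-zero, of dimensions 4×3, with unique bifix urr, so a = 4, c = 3, b = 2, d = 2). Then for all integers m ≥ n ≥ 1, in ℚ: s_p(n, m) = (m − n + 1) · Σ (−1)^{j+l} · M(n − 3j − 2k − l; j, k, l) · (1/(n − 3j − 2k − l)) · C(m + n − 6j − 4(k+l), n − 3j − 2(k+l) − 1), where the sum is over all j, k, l ≥ 0 with 4j + 3k + 2l ≤ n, M(N; j,k,l) = N!/(j!·k!·l!·(N−j−k−l)!) is the multinomial coefficient, and the binomial coefficient C(x, y) is taken to be 0 when y < 0. -/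

import Mathlib

/-- A step of a lattice path: `u` (up) or `r` (right). -/
inductive Step : Type
  | u : Step
  | r : Step
deriving DecidableEq

/-- A word over the alphabet `{u, r}`. -/
abbrev Word := List Step

/-- The number of letters `r` in a word. -/
def countR (w : Word) : ℕ := w.count Step.r

/-- The number of letters `u` in a word. -/
def countU (w : Word) : ℕ := w.count Step.u

/-- `dval q` = (number of `r`'s in `q`) - (number of `u`'s in `q`). -/
def dval (w : Word) : ℤ := (countR w : ℤ) - (countU w : ℤ)

/-- A pattern is depth-zero if every suffix `q` of it satisfies `dval q ≥ 0`. -/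
def DepthZero (p : Word) : Prop := ∀ q : Word, q <:+ p → 0 ≤ dval q

/-- `o` is a bifix of `p`: a nonempty proper prefix of `p` that is also a (proper) suffix. -/
def IsBifix (o p : Word) : Prop := o ≠ [] ∧ o ≠ p ∧ o <+: p ∧ o <:+ p

/-- A pattern is bifix-free if it has no bifix. -/
def BifixFree (p : Word) : Prop := ∀ o : Word, ¬ IsBifix o p

/-- `w` is a ballot path to the lattice point `(n, m)`: it has exactly `n` letters `r`
and `m` letters `u`, and every prefix has at least as many `u`'s as `r`'s. -/
def IsBallot (w : Word) (n m : ℤ) : Prop :=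
  (countR w : ℤ) = n ∧ (countU w : ℤ) = m ∧
    ∀ t : Word, t <+: w → countR t ≤ countU t

/-- `w` avoids the pattern `p`: `p` does not occur in `w` as a contiguous substring. -/
def Avoids (p w : Word) : Prop := ¬ p <:+: w

/-- `s p n m` is the number of ballot paths to `(n, m)` avoiding `p`
(`0` if `n < 0`, `m < 0`, or `m < n`, since then no such path exists). -/
noncomputable def s (p : Word) (n m : ℤ) : ℕ :=
  Set.ncard {w : Word | IsBallot w n m ∧ Avoids p w}

/-- The pattern `urruurr`. -/
def urruurr : Word := [Step.u, Step.r, Step.r, Step.u, Step.u, Step.r, Step.r]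

open PowerSeries in
/-- The generating series, along the diagonal `m = n + h`, of the numbers of ballot paths
avoiding `urruurr`. -/
noncomputable def avoidSeries (h : ℕ) : ℚ⟦X⟧ :=
  PowerSeries.mk fun n => (s urruurr (n : ℤ) ((n : ℤ) + h) : ℚ)

instance : Finite Step :=
  Finite.of_injective (fun x : Step => decide (x = Step.u)) (by
    intro x y; cases x <;> cases y <;> simp)

theorem finite_isBallot (n m : ℤ) : {w : Word | IsBallot w n m}.Finite := by
  refine (List.finite_length_eq Step (n + m).toNat).subset ?_
  rintro w ⟨h1, h2, -⟩
  have h3 : w.length = countR w + countU w := by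
    clear h1 h2
    unfold countR countU
    induction w with
    | nil => rfl
    | cons a w ih => cases a <;> simp [ih] <;> omega
  simp only [Set.mem_ofPred_eq]
  omega

theorem isBallot_concat_u (w : Word) (n m : ℤ) :
    IsBallot (w ++ [Step.u]) n m ↔ IsBallot w n (m - 1) := by
  simp only [IsBallot, List.prefix_concat_iff, countR, countU, List.count_append,
    List.count_singleton]
  constructor
  · rintro ⟨h1, h2, h3⟩
    exact ⟨by simpa using h1, by simp at h2; omega, fun t ht => h3 t (Or.inr ht)⟩
  · rintro ⟨h1, h2, h3⟩
    refine ⟨by simpa using h1, by simp; omega, ?_⟩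
    rintro t (rfl | ht)
    · have := h3 w (List.prefix_refl w)
      simp; omega
    · exact h3 t ht

theorem isBallot_concat_r (w : Word) (n m : ℤ) :
    IsBallot (w ++ [Step.r]) n m ↔ IsBallot w (n - 1) m ∧ n ≤ m := by
  simp only [IsBallot, List.prefix_concat_iff, countR, countU, List.count_append,
    List.count_singleton]
  constructor
  · rintro ⟨h1, h2, h3⟩
    have := h3 _ (Or.inl rfl)
    simp at this h1 h2
    exact ⟨⟨by omega, h2, fun t ht => h3 t (Or.inr ht)⟩, by omega⟩
  · rintro ⟨⟨h1, h2, h3⟩, h4⟩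
    refine ⟨by simp; omega, by simpa using h2, ?_⟩
    rintro t (rfl | ht)
    · simp; omega
    · exact h3 t ht

theorem isBallot_nil (n m : ℤ) : IsBallot [] n m ↔ n = 0 ∧ m = 0 := by
  simp [IsBallot, countR, countU, eq_comm]

theorem IsBallot.nonneg {w : Word} {n m : ℤ} (h : IsBallot w n m) : 0 ≤ n ∧ n ≤ m := by
  obtain ⟨h1, h2, h3⟩ := h
  have := h3 w (List.prefix_refl w)
  omega

theorem s_eq_zero {p : Word} {n m : ℤ} (h : n < 0 ∨ m < n) : s p n m = 0 := by
  have : {w : Word | IsBallot w n m ∧ Avoids p w} = ∅ := by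
    ext w
    simp only [Set.mem_ofPred_eq, Set.mem_empty_iff_false, iff_false, not_and]
    intro hw
    have := hw.nonneg
    omega
  rw [s, this, Set.ncard_empty]

/-- The number of ballot paths to `(n, m)` whose only occurrence of `p` is at the end. -/
noncomputable def firstHit (p : Word) (n m : ℤ) : ℕ :=
  Set.ncard {w : Word | IsBallot w n m ∧ p <:+ w ∧ Avoids p w.dropLast}

theorem firstHit_eq_zero {p : Word} {n m : ℤ} (h : n < 0 ∨ m < n) : firstHit p n m = 0 := by
  have : {w : Word | IsBallot w n m ∧ p <:+ w ∧ Avoids p w.dropLast} = ∅ := by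
    ext w
    simp only [Set.mem_ofPred_eq, Set.mem_empty_iff_false, iff_false, not_and]
    intro hw
    have := hw.nonneg
    omega
  rw [firstHit, this, Set.ncard_empty]

theorem avoids_concat (p w : Word) (a : Step) :
    Avoids p (w ++ [a]) ↔ ¬ p <:+ w ++ [a] ∧ Avoids p w := by
  simp only [Avoids, List.infix_concat_iff, not_or]

theorem s_add_firstHit {p : Word} {n m : ℤ} (hnm : n ≤ m) (h0 : m ≠ 0) :
    s p n m + firstHit p n m = s p (n - 1) m + s p n (m - 1) := by
  unfold s firstHit
  rw [← Set.ncard_union_eq _ ((finite_isBallot n m).subset fun w hw => hw.1)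
    ((finite_isBallot n m).subset fun w hw => hw.1),
    ← Set.ncard_image_of_injective {w : Word | IsBallot w (n - 1) m ∧ Avoids p w}
      (List.append_left_injective [Step.r]),
    ← Set.ncard_image_of_injective {w : Word | IsBallot w n (m - 1) ∧ Avoids p w}
      (List.append_left_injective [Step.u]),
    ← Set.ncard_union_eq _
      (((finite_isBallot (n - 1) m).subset fun w hw => hw.1).image _)
      (((finite_isBallot n (m - 1)).subset fun w hw => hw.1).image _)]
  · congr 1
    ext w
    rcases List.eq_nil_or_concat' w with rfl | ⟨v, a, rfl⟩
    · simp [isBallot_nil, h0]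
    · cases a
      · simp [isBallot_concat_u, avoids_concat]
        tauto
      · simp [isBallot_concat_r, avoids_concat, hnm]
        tauto
  · rw [Set.disjoint_left]
    rintro _ ⟨v, -, rfl⟩ ⟨w, -, h⟩
    simp at h
  · rw [Set.disjoint_left]
    rintro w ⟨-, h⟩ ⟨-, h', -⟩
    exact h h'.isInfix

theorem firstHit_urruurr {n m : ℤ} (hnm : n ≤ m) :
    firstHit urruurr n m + firstHit urruurr (n - 2) (m - 2) = s urruurr (n - 4) (m - 3) := by
  have key : {w : Word | IsBallot w (n - 4) (m - 3) ∧ Avoids urruurr w} =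
      {w | (IsBallot w (n - 4) (m - 3) ∧ Avoids urruurr w) ∧
        ¬ urruurr <:+ w ++ [Step.u, Step.r, Step.r]} ∪
      {w | (IsBallot w (n - 4) (m - 3) ∧ Avoids urruurr w) ∧
        urruurr <:+ w ++ [Step.u, Step.r, Step.r]} := by
    ext w
    simp only [Set.mem_ofPred_eq, Set.mem_union]
    tauto
  have concat3 (w : Word) (a b c : Step) : w ++ [a, b, c] = w ++ [a] ++ [b] ++ [c] := by simp
  have concat7 (w : Word) : w ++ urruurr =
    w ++ [Step.u] ++ [Step.r] ++ [Step.r] ++ [Step.u] ++ [Step.u] ++ [Step.r] ++ [Step.r] := by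
    simp [urruurr]
  rw [s, key, Set.ncard_union_eq _
    ((finite_isBallot (n - 4) (m - 3)).subset fun w hw => hw.1.1)
    ((finite_isBallot (n - 4) (m - 3)).subset fun w hw => hw.1.1),
    firstHit, firstHit]
  · congr 1
    · rw [← Set.ncard_image_of_injective
        {w | (IsBallot w (n - 4) (m - 3) ∧ Avoids urruurr w) ∧
          ¬ urruurr <:+ w ++ [Step.u, Step.r, Step.r]} (List.append_left_injective urruurr)]
      congr 1
      ext v
      simp only [Set.mem_ofPred_eq, Set.mem_image]
      have main (w : Word) : (IsBallot (w ++ urruurr) n m ∧ Avoids urruurr (w ++ urruurr).dropLast) ↔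
          (IsBallot w (n - 4) (m - 3) ∧ Avoids urruurr w) ∧
            ¬ urruurr <:+ w ++ [Step.u, Step.r, Step.r] := by
        rw [concat7]
        simp only [isBallot_concat_r, isBallot_concat_u, List.dropLast_concat, avoids_concat]
        have e1 : n - 1 - 1 - 1 - 1 = n - 4 := by ring
        have e2 : m - 1 - 1 - 1 = m - 3 := by ring
        rw [e1, e2]
        simp only [← List.reverse_prefix]
        simp [urruurr]
        have e3 : n ≤ m + 1 := by omega
        tauto
      constructor
      · rintro ⟨h1, ⟨w, rfl⟩, h2⟩
        exact ⟨w, (main w).1 ⟨h1, h2⟩, rfl⟩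
      · rintro ⟨w, h, rfl⟩
        exact ⟨((main w).2 h).1, List.suffix_append _ _, ((main w).2 h).2⟩
    · rw [← Set.ncard_image_of_injective
        {w | (IsBallot w (n - 4) (m - 3) ∧ Avoids urruurr w) ∧
          urruurr <:+ w ++ [Step.u, Step.r, Step.r]}
        (List.append_left_injective [Step.u, Step.r, Step.r])]
      congr 1
      ext v
      simp only [Set.mem_ofPred_eq, Set.mem_image]
      have main (w : Word) : (IsBallot (w ++ [Step.u, Step.r, Step.r]) (n - 2) (m - 2) ∧
          Avoids urruurr (w ++ [Step.u, Step.r, Step.r]).dropLast) ↔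
          (IsBallot w (n - 4) (m - 3) ∧ Avoids urruurr w) := by
        rw [concat3]
        simp only [isBallot_concat_r, isBallot_concat_u, List.dropLast_concat, avoids_concat]
        have e1 : n - 2 - 1 - 1 = n - 4 := by ring
        have e2 : m - 2 - 1 = m - 3 := by ring
        rw [e1, e2]
        simp only [← List.reverse_prefix]
        simp [urruurr]
        have e3 : n ≤ m - 2 + 1 + 2 := by omega
        tauto
      constructor
      · rintro ⟨h1, ⟨x, rfl⟩, h2⟩
        refine ⟨x ++ [Step.u, Step.r, Step.r, Step.u], ⟨(main _).1 ⟨?_, ?_⟩, ?_⟩, ?_⟩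
        · simpa [urruurr] using h1
        · simpa [urruurr] using h2
        · simp [urruurr]
        · simp [urruurr]
      · rintro ⟨w, ⟨h, h'⟩, rfl⟩
        exact ⟨((main w).2 h).1, h', ((main w).2 h).2⟩
  · rw [Set.disjoint_left]
    rintro w ⟨-, h⟩ ⟨-, h'⟩
    exact h h'

open PowerSeries in
/-- The generating series, along the diagonal `m = n + h`, of the numbers of ballot paths
whose only occurrence of `urruurr` is at the end. -/
noncomputable def hitSeries (h : ℕ) : ℚ⟦X⟧ :=
  PowerSeries.mk fun n => (firstHit urruurr (n : ℤ) ((n : ℤ) + h) : ℚ)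

theorem one_add_X_sq_mul_hitSeries (h : ℕ) :
    (1 + PowerSeries.X ^ 2) * hitSeries h = PowerSeries.X ^ 4 * avoidSeries (h + 1) := by
  ext n
  rw [add_mul, one_mul, map_add, PowerSeries.coeff_X_pow_mul', PowerSeries.coeff_X_pow_mul']
  simp only [hitSeries, avoidSeries, PowerSeries.coeff_mk]
  have key := firstHit_urruurr (n := n) (m := n + h) (by omega)
  have h2 : (if 2 ≤ n then
      (firstHit urruurr ((n - 2 : ℕ) : ℤ) (((n - 2 : ℕ) : ℤ) + h) : ℚ) else 0) =
      (firstHit urruurr ((n : ℤ) - 2) ((n : ℤ) + h - 2) : ℚ) := by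
    split_ifs with hn
    · congr 2 <;> omega
    · rw [firstHit_eq_zero (by omega)]; simp
  have h4 : (if 4 ≤ n then
      (s urruurr ((n - 4 : ℕ) : ℤ) (((n - 4 : ℕ) : ℤ) + (h + 1 : ℕ)) : ℚ) else 0) =
      (s urruurr ((n : ℤ) - 4) ((n : ℤ) + h - 3) : ℚ) := by
    split_ifs with hn
    · congr 2 <;> omega
    · rw [s_eq_zero (by omega)]; simp
  rw [h2, h4]
  exact_mod_cast key

theorem coeff_X_mul_avoidSeries (h n : ℕ) :
    PowerSeries.coeff n (PowerSeries.X * avoidSeries (h + 1)) =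
      (s urruurr ((n : ℤ) - 1) ((n : ℤ) + h) : ℚ) := by
  cases n with
  | zero => rw [s_eq_zero (by omega)]; simp
  | succ n =>
    rw [PowerSeries.coeff_succ_X_mul, avoidSeries, PowerSeries.coeff_mk]
    congr 2 <;> push_cast <;> ring

theorem avoidSeries_zero_add_hitSeries :
    avoidSeries 0 + hitSeries 0 = 1 + PowerSeries.X * avoidSeries 1 := by
  ext n
  rw [map_add, map_add, coeff_X_mul_avoidSeries 0, avoidSeries, hitSeries, PowerSeries.coeff_mk,
    PowerSeries.coeff_mk, PowerSeries.coeff_one]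
  split_ifs with hn
  · subst hn
    have h1 : s urruurr 0 0 = 1 := by
      have : {w : Word | IsBallot w 0 0 ∧ Avoids urruurr w} = {[]} := by
        ext w
        rcases List.eq_nil_or_concat' w with rfl | ⟨v, a, rfl⟩
        · simp [isBallot_nil, Avoids, urruurr]
        · simp only [Set.mem_ofPred_eq, Set.mem_singleton_iff]
          refine ⟨fun hv => ?_, fun hv => by simp at hv⟩
          cases a
          · have := ((isBallot_concat_u _ _ _).1 hv.1).nonneg
            omega
          · have := ((isBallot_concat_r _ _ _).1 hv.1).1.nonneg
            omega
      rw [s, this, Set.ncard_singleton]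
    have h2 := firstHit_urruurr (n := 0) (m := 0) le_rfl
    rw [s_eq_zero (by omega)] at h2
    have h3 : firstHit urruurr 0 0 = 0 := by omega
    rw [s_eq_zero (n := ((0 : ℕ) : ℤ) - 1) (by omega)]
    simp [h1, h3]
  · have key := s_add_firstHit (p := urruurr) (n := n) (m := n) le_rfl (by omega)
    rw [s_eq_zero (n := (n : ℤ)) (m := n - 1) (by omega)] at key
    simp only [Nat.cast_zero, add_zero, zero_add] at key ⊢
    exact_mod_cast key

theorem avoidSeries_succ_add_hitSeries (h : ℕ) :
    avoidSeries (h + 1) + hitSeries (h + 1) =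
      avoidSeries h + PowerSeries.X * avoidSeries (h + 2) := by
  ext n
  rw [map_add, map_add, coeff_X_mul_avoidSeries (h + 1)]
  simp only [avoidSeries, hitSeries, PowerSeries.coeff_mk]
  have key := s_add_firstHit (p := urruurr) (n := n) (m := n + (h + 1 : ℕ)) (by omega) (by omega)
  have e : (n : ℤ) + (h + 1 : ℕ) - 1 = n + h := by push_cast; ring
  rw [e] at key
  rw [add_comm (s urruurr _ ((n : ℤ) + h) : ℚ)]
  exact_mod_cast key

/-- The number of ballot paths to `(k, k + h)`. -/
def ballotNumber (k h : ℕ) : ℚ :=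
  if k = 0 then 1 else ((h : ℚ) + 1) * (1 / (k : ℚ)) * ((2 * k + h).choose (k - 1) : ℚ)

theorem ballotNumber_succ_zero (k : ℕ) : ballotNumber (k + 1) 0 = ballotNumber k 1 := by
  rcases k with _ | k
  · simp [ballotNumber]
  · simp only [ballotNumber, Nat.add_eq_zero_iff, one_ne_zero, and_false, if_false]
    have h1 := Nat.add_one_mul_choose_eq (2 * k + 3) k
    have e1 : 2 * (k + 1 + 1) + 0 = 2 * k + 3 + 1 := by ring
    have e2 : 2 * (k + 1) + 1 = 2 * k + 3 := by ring
    rw [e1, e2, Nat.add_sub_cancel, Nat.add_sub_cancel]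
    have h2 : ((2 * k + 3 : ℚ) + 1) * ((2 * k + 3).choose k : ℚ) =
        ((2 * k + 3 + 1).choose (k + 1) : ℚ) * (k + 1) := by exact_mod_cast h1
    push_cast
    have : (k : ℚ) + 1 ≠ 0 := by positivity
    have : (k : ℚ) + 1 + 1 ≠ 0 := by positivity
    field_simp
    linear_combination -h2

theorem ballotNumber_succ_succ (k h : ℕ) :
    ballotNumber (k + 1) (h + 1) = ballotNumber k (h + 2) + ballotNumber (k + 1) h := by
  rcases k with _ | k
  · simp [ballotNumber]
    ring
  · simp only [ballotNumber, Nat.add_eq_zero_iff, one_ne_zero, and_false, if_false]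
    have h1 := Nat.choose_succ_right_eq (2 * k + 4 + h) k
    have e1 : 2 * (k + 1 + 1) + (h + 1) = 2 * k + 4 + h + 1 := by ring
    have e2 : 2 * (k + 1) + (h + 2) = 2 * k + 4 + h := by ring
    have e3 : 2 * (k + 1 + 1) + h = 2 * k + 4 + h := by ring
    have e4 : 2 * k + 4 + h - k = k + 4 + h := by omega
    rw [e1, e2, e3, Nat.add_sub_cancel, Nat.add_sub_cancel, Nat.choose_succ_succ]
    rw [e4] at h1
    have h2 : ((2 * k + 4 + h).choose (k + 1) : ℚ) * (k + 1) =
        ((2 * k + 4 + h).choose k : ℚ) * (k + 4 + h) := by exact_mod_cast h1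
    push_cast
    have : (k : ℚ) + 1 ≠ 0 := by positivity
    have : (k : ℚ) + 1 + 1 ≠ 0 := by positivity
    field_simp
    linear_combination h2

/-- A family of series satisfying the ballot recurrence with weight `q` is given, modulo powers
of `X`, by the ballot numbers. -/
theorem X_pow_dvd_sub_sum_ballotNumber {A : ℕ → PowerSeries ℚ} {q : PowerSeries ℚ}
    (hq : PowerSeries.X ∣ q) (h0 : A 0 = 1 + q * A 1)
    (hA : ∀ h, A (h + 1) = A h + q * A (h + 2)) (N h : ℕ) :
    PowerSeries.X ^ N ∣ A h -
      ∑ k ∈ Finset.range N, PowerSeries.C (ballotNumber k h) * q ^ k := by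
  induction N generalizing h with
  | zero => simp
  | succ N ih =>
    have step (h : ℕ) : PowerSeries.X ^ (N + 1) ∣ q * A (h + 1) -
        ∑ k ∈ Finset.range N, PowerSeries.C (ballotNumber k (h + 1)) * q ^ (k + 1) := by
      have := mul_dvd_mul hq (ih (h + 1))
      rw [← pow_succ', mul_sub, Finset.mul_sum] at this
      convert this using 3
      ring
    induction h with
    | zero =>
      convert step 0 using 1
      rw [h0, Finset.sum_range_succ']
      simp only [ballotNumber_succ_zero]
      simp only [ballotNumber, if_true, pow_zero, map_one, zero_add]
      ring
    | succ h ihh =>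
      convert dvd_add ihh (step (h + 1)) using 1
      rw [hA, Finset.sum_range_succ', Finset.sum_range_succ']
      simp only [ballotNumber_succ_succ, map_add, add_mul, Finset.sum_add_distrib]
      simp only [ballotNumber, if_true]
      ring

/-- The first terms of the expansion of `(1 + X²)⁻ᵏ`. -/
noncomputable def invTrunc (N k : ℕ) : PowerSeries ℚ :=
  ∑ l ∈ Finset.range (N + 1),
    PowerSeries.C ((-1) ^ l * ((k + l - 1).choose l : ℚ)) * PowerSeries.X ^ (2 * l)

theorem one_add_X_sq_mul_invTrunc (N k : ℕ) :
    (1 + PowerSeries.X ^ 2) * invTrunc N (k + 1) = invTrunc N k +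
      PowerSeries.C ((-1) ^ N * ((k + N).choose N : ℚ)) * PowerSeries.X ^ (2 * (N + 1)) := by
  induction N with
  | zero => simp [invTrunc]
  | succ N ih =>
    have e1 (k : ℕ) : invTrunc (N + 1) k = invTrunc N k +
        PowerSeries.C ((-1) ^ (N + 1) * ((k + (N + 1) - 1).choose (N + 1) : ℚ)) *
          PowerSeries.X ^ (2 * (N + 1)) :=
      Finset.sum_range_succ _ _
    have e2 : k + (N + 1) - 1 = k + N := by omega
    have e3 : k + 1 + (N + 1) - 1 = k + N + 1 := by omega
    have e4 : ((k + N + 1).choose (N + 1) : ℚ) =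
        ((k + N).choose N : ℚ) + ((k + N).choose (N + 1) : ℚ) := by
      exact_mod_cast Nat.choose_succ_succ _ _
    rw [e1, e1, mul_add, ih, e2, e3, ← add_assoc, e4]
    simp only [map_mul, map_add, map_pow, map_neg, map_one]
    ring

theorem X_pow_dvd_invTrunc (N k : ℕ) :
    (PowerSeries.X : PowerSeries ℚ) ^ (2 * (N + 1)) ∣
      (1 + PowerSeries.X ^ 2) ^ k * invTrunc N k - 1 := by
  induction k with
  | zero =>
    rw [invTrunc, Finset.sum_range_succ', Finset.sum_eq_zero]
    · simp
    · intro l _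
      rw [Nat.choose_eq_zero_of_lt (by omega)]
      simp
  | succ k ih =>
    rw [pow_succ, mul_assoc, one_add_X_sq_mul_invTrunc]
    convert dvd_add ih (Dvd.intro_left ((1 + PowerSeries.X ^ 2) ^ k *
      PowerSeries.C ((-1) ^ N * ((k + N).choose N : ℚ))) rfl) using 1
    ring

theorem add_pow_eq_sum_range_of_le {R : Type*} [CommSemiring R] (x y : R) {K N : ℕ} (h : K ≤ N) :
    (x + y) ^ K = ∑ i ∈ Finset.range (N + 1), x ^ i * y ^ (K - i) * (K.choose i : R) := by
  rw [add_pow]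
  refine Finset.sum_subset (Finset.range_subset_range.2 (by omega)) fun i _ hi => ?_
  rw [Finset.mem_range, not_lt] at hi
  rw [Nat.choose_eq_zero_of_lt (by omega)]
  simp

theorem trinomial_pow_eq_sum {K N : ℕ} (h : K ≤ N) :
    (1 + PowerSeries.X ^ 2 - PowerSeries.X ^ 3 : PowerSeries ℚ) ^ K =
      ∑ j ∈ Finset.range (N + 1), ∑ k ∈ Finset.range (N + 1),
        PowerSeries.C ((-1) ^ j * (K.choose j : ℚ) * ((K - j).choose k : ℚ)) *
          PowerSeries.X ^ (3 * j + 2 * k) := by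
  have e : (1 + PowerSeries.X ^ 2 - PowerSeries.X ^ 3 : PowerSeries ℚ) =
      -PowerSeries.X ^ 3 + (PowerSeries.X ^ 2 + 1) := by ring
  rw [e, add_pow_eq_sum_range_of_le _ _ h]
  refine Finset.sum_congr rfl fun j _ => ?_
  rw [add_pow_eq_sum_range_of_le _ _ ((Nat.sub_le K j).trans h), Finset.mul_sum, Finset.sum_mul]
  refine Finset.sum_congr rfl fun k _ => ?_
  simp only [map_mul, map_pow, map_neg, map_one, map_natCast, one_pow]
  rw [neg_pow, ← pow_mul, ← pow_mul, pow_add]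
  ring

/-- The series `(X + X³ - X⁴) / (1 + X²)`. -/
noncomputable def weightSeries : PowerSeries ℚ :=
  PowerSeries.X * (1 + PowerSeries.X ^ 2 - PowerSeries.X ^ 3) * (1 + PowerSeries.X ^ 2)⁻¹

theorem weightSeries_mul :
    weightSeries * (1 + PowerSeries.X ^ 2) =
      PowerSeries.X * (1 + PowerSeries.X ^ 2 - PowerSeries.X ^ 3) := by
  rw [weightSeries, mul_assoc, PowerSeries.inv_mul_cancel _ (by simp), mul_one]

theorem coeff_weightSeries_pow {n K : ℕ} (h : K ≤ n) :
    PowerSeries.coeff n (weightSeries ^ K) =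
      ∑ j ∈ Finset.range (n + 1), ∑ k ∈ Finset.range (n + 1), ∑ l ∈ Finset.range (n + 1),
        if n = K + 3 * j + 2 * k + 2 * l then
          (-1) ^ (j + l) * (K.choose j : ℚ) * ((K - j).choose k : ℚ) *
            ((K + l - 1).choose l : ℚ)
        else 0 := by
  have h1 : (PowerSeries.X : PowerSeries ℚ) ^ (2 * (n + 1)) ∣
      (PowerSeries.X * (1 + PowerSeries.X ^ 2 - PowerSeries.X ^ 3)) ^ K * invTrunc n K -
        weightSeries ^ K := by
    convert (X_pow_dvd_invTrunc n K).mul_left (weightSeries ^ K) using 1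
    rw [← weightSeries_mul, mul_pow]
    ring
  have h2 := PowerSeries.X_pow_dvd_iff.1 h1 n (by omega)
  rw [map_sub, sub_eq_zero] at h2
  rw [← h2, mul_pow, trinomial_pow_eq_sum h, Finset.mul_sum, Finset.sum_mul, map_sum]
  refine Finset.sum_congr rfl fun j _ => ?_
  rw [Finset.mul_sum, Finset.sum_mul, map_sum]
  refine Finset.sum_congr rfl fun k _ => ?_
  rw [invTrunc, Finset.mul_sum, map_sum]
  refine Finset.sum_congr rfl fun l _ => ?_
  rw [← boole_mul, mul_comm (ite _ _ _), ← PowerSeries.coeff_X_pow, ← PowerSeries.coeff_C_mul]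
  congr 1
  simp only [map_mul, map_pow, map_neg, map_one, map_natCast]
  ring

theorem avoidSeries_recurrence (h : ℕ) (B : PowerSeries ℚ)
    (hB : avoidSeries h + hitSeries h = B + PowerSeries.X * avoidSeries (h + 1)) :
    avoidSeries h = B + weightSeries * avoidSeries (h + 1) := by
  have hne : (1 + PowerSeries.X ^ 2 : PowerSeries ℚ) ≠ 0 := by
    intro h0
    simpa using congrArg PowerSeries.constantCoeff h0
  apply mul_left_cancel₀ hne
  linear_combination (1 + PowerSeries.X ^ 2) * hB - one_add_X_sq_mul_hitSeries h -
    avoidSeries (h + 1) * weightSeries_mul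

theorem s_urruurr_eq_sum (n h : ℕ) :
    (s urruurr n ((n : ℤ) + h) : ℚ) =
      ∑ K ∈ Finset.range (n + 1),
        ballotNumber K h * PowerSeries.coeff n (weightSeries ^ K) := by
  have h1 := X_pow_dvd_sub_sum_ballotNumber (A := avoidSeries) (q := weightSeries)
    ⟨_, mul_assoc _ _ _⟩
    (avoidSeries_recurrence 0 1 avoidSeries_zero_add_hitSeries)
    (fun h => avoidSeries_recurrence (h + 1) _ (avoidSeries_succ_add_hitSeries h)) (n + 1) h
  have h2 := PowerSeries.X_pow_dvd_iff.1 h1 n (by omega)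
  rw [map_sub, sub_eq_zero, map_sum] at h2
  simpa [avoidSeries] using h2

theorem multinomial_div_eq {K j k l : ℕ} (h : j + k ≤ K) :
    (K + l).factorial / (j.factorial * k.factorial * l.factorial * (K + l - j - k - l).factorial) =
      (K + l).choose l * K.choose j * (K - j).choose k := by
  have e : K + l - j - k - l = K - j - k := by omega
  rw [e]
  apply Nat.div_eq_of_eq_mul_left (by positivity)
  rw [← Nat.add_choose_mul_factorial_mul_factorial K l,
    ← Nat.choose_mul_factorial_mul_factorial (show j ≤ K by omega),
    ← Nat.choose_mul_factorial_mul_factorial (show k ≤ K - j by omega)]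
  ring

theorem choose_div_add {K l : ℕ} (hK : K ≠ 0) :
    ((K + l).choose l : ℚ) * (1 / ((K + l : ℕ) : ℚ)) = (K + l - 1).choose l * (1 / (K : ℚ)) := by
  obtain ⟨K, rfl⟩ := Nat.exists_eq_succ_of_ne_zero hK
  have h1 := Nat.add_one_mul_choose_eq (K + l) K
  have e1 : K + 1 + l = K + l + 1 := by ring
  have e2 : (K + l + 1).choose l = (K + l + 1).choose (K + 1) := by
    rw [← Nat.choose_symm_of_eq_add]; ring
  have e3 : (K + l).choose l = (K + l).choose K := by
    rw [← Nat.choose_symm_of_eq_add]; ring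
  rw [Nat.succ_eq_add_one, e1, Nat.add_sub_cancel, e2, e3]
  have h2 : ((K + l + 1 : ℕ) : ℚ) * ((K + l).choose K : ℚ) =
      ((K + l + 1).choose (K + 1) : ℚ) * ((K + 1 : ℕ) : ℚ) := by exact_mod_cast h1
  have : ((K + l + 1 : ℕ) : ℚ) ≠ 0 := by positivity
  have : ((K + 1 : ℕ) : ℚ) ≠ 0 := by positivity
  field_simp
  linear_combination -h2

theorem sum_ballotNumber_mul_eq (n h j k l : ℕ) (hn : 1 ≤ n) :
    (∑ K ∈ Finset.range (n + 1), ballotNumber K h *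
      if n = K + 3 * j + 2 * k + 2 * l then
        (-1) ^ (j + l) * (K.choose j : ℚ) * ((K - j).choose k : ℚ) * ((K + l - 1).choose l : ℚ)
      else 0) =
    if 4 * j + 3 * k + 2 * l ≤ n then
      (((n + h : ℕ) : ℚ) - n + 1) * ((-1 : ℚ) ^ (j + l) *
        ((Nat.factorial (n - 3 * j - 2 * k - l) /
            (Nat.factorial j * Nat.factorial k * Nat.factorial l *
              Nat.factorial ((n - 3 * j - 2 * k - l) - j - k - l)) : ℕ) : ℚ) *
        (1 / ((n - 3 * j - 2 * k - l : ℕ) : ℚ)) *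
        (if l < n - 3 * j - 2 * k - l then
            ((Nat.choose (n + h + n - 6 * j - 4 * (k + l)) (n - 3 * j - 2 * (k + l) - 1)) : ℚ)
          else 0))
    else 0 := by
  by_cases hle : 3 * j + 2 * k + 2 * l ≤ n
  · obtain ⟨K, hK⟩ := Nat.exists_eq_add_of_le' hle
    rw [Finset.sum_eq_single K]
    · rw [if_pos (by omega)]
      split_ifs with h1 h2
      · have e1 : n - 3 * j - 2 * k - l = K + l := by omega
        have e2 : n + h + n - 6 * j - 4 * (k + l) = 2 * K + h := by omega
        have e3 : n - 3 * j - 2 * (k + l) - 1 = K - 1 := by omega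
        have hK0 : K ≠ 0 := by omega
        rw [e1, e2, e3, multinomial_div_eq (by omega), ballotNumber, if_neg hK0]
        push_cast
        have := choose_div_add (l := l) hK0
        push_cast at this
        linear_combination (-((h : ℚ) + 1) * (-1) ^ (j + l) * K.choose j * (K - j).choose k *
          (2 * K + h).choose (K - 1)) * this
      · rw [Nat.choose_eq_zero_of_lt (show K + l - 1 < l by omega)]
        simp
      · rcases lt_or_ge K j with hj | hj
        · rw [Nat.choose_eq_zero_of_lt hj]
          simp
        · rw [Nat.choose_eq_zero_of_lt (show K - j < k by omega)]
          simp
    · intro b _ hb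
      rw [if_neg (by omega), mul_zero]
    · intro hb
      exact absurd (Finset.mem_range.2 (by omega)) hb
  · rw [if_neg (by omega)]
    refine Finset.sum_eq_zero fun K _ => ?_
    rw [if_neg (by omega), mul_zero]

/-- Explicit formula for ballot paths avoiding `urruurr` (depth-zero, dimensions `4 × 3`,
unique bifix `urr`, so `a = 4`, `c = 3`, `b = 2`, `d = 2`): for `m ≥ n ≥ 1`,
`s p n m = (m-n+1) ∑_{j,k,l ≥ 0, 4j+3k+2l ≤ n} (-1)^{j+l} M(n-3j-2k-l; j,k,l)
  (1/(n-3j-2k-l)) C(m+n-6j-4(k+l), n-3j-2(k+l)-1)`,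
where `C(x,y) = 0` for `y < 0` and `M` is the multinomial coefficient. -/
theorem ballot_avoiding_urruurr_formula (n m : ℕ) (hn : 1 ≤ n) (hnm : n ≤ m) :
    (s urruurr n m : ℚ) = ((m : ℚ) - n + 1) *
      ∑ x ∈ Finset.filter
          (fun x : ℕ × ℕ × ℕ => 4 * x.1 + 3 * x.2.1 + 2 * x.2.2 ≤ n)
          (Finset.range (n + 1) ×ˢ Finset.range (n + 1) ×ˢ Finset.range (n + 1)),
        (-1 : ℚ) ^ (x.1 + x.2.2) *
          ((Nat.factorial (n - 3 * x.1 - 2 * x.2.1 - x.2.2) /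
              (Nat.factorial x.1 * Nat.factorial x.2.1 * Nat.factorial x.2.2 *
                Nat.factorial ((n - 3 * x.1 - 2 * x.2.1 - x.2.2) - x.1 - x.2.1 - x.2.2)) : ℕ) : ℚ) *
          (1 / ((n - 3 * x.1 - 2 * x.2.1 - x.2.2 : ℕ) : ℚ)) *
          (if x.2.2 < n - 3 * x.1 - 2 * x.2.1 - x.2.2 then
              ((Nat.choose (m + n - 6 * x.1 - 4 * (x.2.1 + x.2.2))
                (n - 3 * x.1 - 2 * (x.2.1 + x.2.2) - 1)) : ℚ)
            else 0) := by
  obtain ⟨h, rfl⟩ := Nat.exists_eq_add_of_le hnm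
  rw [Nat.cast_add (R := ℤ), s_urruurr_eq_sum, Finset.mul_sum, Finset.sum_filter,
    Finset.sum_product]
  simp only [Finset.sum_product]
  rw [Finset.sum_congr rfl fun K hK => by
    rw [coeff_weightSeries_pow (Nat.lt_succ_iff.1 (Finset.mem_range.1 hK)), Finset.mul_sum],
    Finset.sum_comm]
  refine Finset.sum_congr rfl fun j _ => ?_
  simp only [Finset.mul_sum]
  rw [Finset.sum_comm]
  refine Finset.sum_congr rfl fun k _ => ?_
  rw [Finset.sum_comm]
  refine Finset.sum_congr rfl fun l _ => ?_
  exact sum_ballotNumber_mul_eq n h j k l hn
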